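/- (Microscopic parts at zeros, rotating chord.) Let φ be a Jacob's ladder on [T₀,∞) with k₁T ≤ φ(T) ≤ k₂T for all T ≥ T₀ (for some constants 0 < k₁ ≤ k₂), and assume the Balasubramanian formula: for every ε > 0, ∫₀^T Z(t)² dt = T ln T + (2c − 1 − ln 2π)T + O(T^{1/3+ε}) as T → ∞. Fix ε > 0. Then, as γ → ∞ through the zeros of ζ(1/2+it) (i.e. ζ(1/2+iγ) = 0), uniformly for 0 < U ≤ γ^{1/3+2ε}, one has ∫_γ^{γ+U} Z(t)² dt = (U·ln(φ(γ)/2) − aU)·tan α(γ,U) + O(γ^{−(1/3−4ε)}), where tan α(γ,U) = [φ(γ+U) − φ(γ)]/(2U) is the slope of the chord of the curve y = φ(t)/2 joining (γ, φ(γ)/2) and (γ+U, φ(γ+U)/2); in particular this holds for all microscopic lengths 0 < U < 1. -/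

import Mathlib

open Real MeasureTheory Filter

/-- `Z(t)²`, i.e. `|ζ(1/2 + it)|²`. -/
noncomputable def Z2 (t : ℝ) : ℝ := ‖riemannZeta (1/2 + Complex.I * t)‖ ^ 2

/-- The constant `a = ln(2π) − 1 − c`, where `c` is the Euler–Mascheroni constant. -/
noncomputable def aConst : ℝ := Real.log (2 * Real.pi) - 1 - Real.eulerMascheroniConstant

lemma continuous_Z2 : Continuous Z2 := by
  unfold Z2
  refine Continuous.pow (Continuous.norm ?_) 2
  rw [continuous_iff_continuousAt]
  intro t
  have hne : (1/2 + Complex.I * t : ℂ) ≠ 1 := by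
    intro h
    have := congrArg Complex.re h
    norm_num at this
  exact ContinuousAt.comp (f := fun t : ℝ => (1/2 + Complex.I * t : ℂ))
    (differentiableAt_riemannZeta hne).continuousAt (by fun_prop)

lemma integral_Z2_sub (s t : ℝ) :
    ∫ u in s..t, Z2 u = (∫ u in (0:ℝ)..t, Z2 u) - ∫ u in (0:ℝ)..s, Z2 u :=
  (intervalIntegral.integral_interval_sub_left (continuous_Z2.intervalIntegrable _ _)
    (continuous_Z2.intervalIntegrable _ _)).symm

/-- The function `x log x` lies above its tangents. -/
lemma tangent_le_mul_log_sub {x y : ℝ} (hx : 0 < x) (hy : 0 < y) :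
    (y - x) * (Real.log x + 1) ≤ y * Real.log y - x * Real.log x := by
  have h := Real.log_le_sub_one_of_pos (div_pos hx hy)
  rw [Real.log_div hx.ne' hy.ne'] at h
  have h2 := mul_le_mul_of_nonneg_left h hy.le
  have h3 : y * (x / y - 1) = x - y := by field_simp
  rw [h3] at h2
  linarith

lemma mul_log_sub_le_tangent_add {x y : ℝ} (hx : 0 < x) (hy : 0 < y) :
    y * Real.log y - x * Real.log x ≤ (y - x) * (Real.log x + 1) + (y - x) ^ 2 / x := by
  have h := Real.log_le_sub_one_of_pos (div_pos hy hx)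
  rw [Real.log_div hy.ne' hx.ne'] at h
  have h2 := mul_le_mul_of_nonneg_left h hy.le
  have h3 : y * (y / x - 1) = (y - x) + (y - x) ^ 2 / x := by field_simp; ring
  rw [h3] at h2
  linarith

lemma mul_log_div_le_rpow (C : ℝ) {s t : ℝ} (hs : 1 ≤ s) (hst : s ≤ t) :
    C * Real.log t / t ≤ 3 / 2 * |C| * s ^ (-(1:ℝ)/3) := by
  have ht : 0 < t := by linarith
  have h1 : Real.log t / t ≤ 3 / 2 * t ^ (-(1:ℝ)/3) := by
    have h := Real.log_le_rpow_div ht.le (show (0:ℝ) < 2/3 by norm_num)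
    rw [div_le_iff₀ ht]
    have h2 : t ^ (-(1:ℝ)/3) * t = t ^ ((2:ℝ)/3) := by
      rw [← Real.rpow_add_one ht.ne']; norm_num
    rw [mul_assoc, h2]
    linarith
  have h2 : t ^ (-(1:ℝ)/3) ≤ s ^ (-(1:ℝ)/3) :=
    Real.rpow_le_rpow_of_nonpos (by linarith) hst (by norm_num)
  have h3 : 0 ≤ Real.log t / t := div_nonneg (Real.log_nonneg (by linarith)) ht.le
  calc C * Real.log t / t = C * (Real.log t / t) := by ring
    _ ≤ |C| * (Real.log t / t) := by gcongr; exact le_abs_self C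
    _ ≤ |C| * (3 / 2 * s ^ (-(1:ℝ)/3)) := by gcongr; linarith
    _ = _ := by ring

/-- The primitive of `Z²` grows by at most a logarithm times the step, up to the error term. -/
lemma integral_Z2_sub_le {p C T₁ : ℝ} (hp : 0 < p) (hp1 : p ≤ 1)
    (hBal : ∀ T ≥ T₁,
      |(∫ t in (0:ℝ)..T, Z2 t) - T * Real.log T
        - (2 * Real.eulerMascheroniConstant - 1 - Real.log (2 * Real.pi)) * T| ≤ C * T ^ p)
    {γ U : ℝ} (hγ : 1 ≤ γ) (hγT : T₁ ≤ γ) (hU : 0 < U) (hUγ : U ≤ γ) :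
    (∫ t in γ..(γ + U), Z2 t) ≤
      U * (Real.log γ + (Real.log 2 + 2 * Real.eulerMascheroniConstant - Real.log (2 * Real.pi)))
        + 4 * |C| * γ ^ p := by
  have h1 := (abs_le.mp (hBal γ hγT)).1
  have h2 := (abs_le.mp (hBal (γ + U) (by linarith))).2
  have h3 := tangent_le_mul_log_sub (x := γ + U) (y := γ) (by linarith) (by linarith)
  have h4 : Real.log (γ + U) ≤ Real.log 2 + Real.log γ := by
    rw [← Real.log_mul (by norm_num) (by linarith)]
    exact Real.log_le_log (by linarith) (by linarith)
  have h5 := mul_le_mul_of_nonneg_left h4 hU.le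
  have h6 : C * (γ + U) ^ p ≤ |C| * (2 * γ ^ p) := by
    have : (γ + U) ^ p ≤ 2 * γ ^ p := calc
      (γ + U) ^ p ≤ (2 * γ) ^ p := Real.rpow_le_rpow (by linarith) (by linarith) hp.le
      _ = 2 ^ p * γ ^ p := Real.mul_rpow (by norm_num) (by linarith)
      _ ≤ 2 ^ (1:ℝ) * γ ^ p := by gcongr; norm_num
      _ = _ := by norm_num
    exact mul_le_mul (le_abs_self C) this (by positivity) (abs_nonneg C)
  have h7 : C * γ ^ p ≤ |C| * γ ^ p := by gcongr; exact le_abs_self C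
  have h8 : 0 ≤ |C| * γ ^ p := by positivity
  rw [integral_Z2_sub]
  nlinarith

/-- The increments of a Jacob's ladder, compared with the tangent of its defining function. -/
lemma ladder_increment_bounds {φ : ℝ → ℝ} {T₀ c₀ C : ℝ}
    (hmono : StrictMonoOn φ (Set.Ici T₀)) (hpos : ∀ T ≥ T₀, 0 < φ T)
    (hlad : ∀ T ≥ T₀,
      |(∫ t in (0:ℝ)..T, Z2 t) - (φ T / 2) * Real.log (φ T / 2)
        - (Real.eulerMascheroniConstant - Real.log (2 * Real.pi)) * (φ T / 2) - c₀|
        ≤ C * Real.log T / T)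
    {γ U : ℝ} (hγ : 1 ≤ γ) (hγT : T₀ ≤ γ) (hU : 0 < U) :
    0 < φ (γ + U) - φ γ ∧
    (φ (γ + U) - φ γ) / 2 * (Real.log (φ γ / 2) - aConst) - 3 * |C| * γ ^ (-(1:ℝ)/3)
      ≤ ∫ t in γ..(γ + U), Z2 t ∧
    ∫ t in γ..(γ + U), Z2 t ≤
      (φ (γ + U) - φ γ) / 2 * (Real.log (φ γ / 2) - aConst) + 3 * |C| * γ ^ (-(1:ℝ)/3)
        + ((φ (γ + U) - φ γ) / 2) ^ 2 / (φ γ / 2) := by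
  have hT' : T₀ ≤ γ + U := by linarith
  have hx : 0 < φ γ / 2 := half_pos (hpos γ hγT)
  have hy : 0 < φ (γ + U) / 2 := half_pos (hpos _ hT')
  have e1 := mul_log_div_le_rpow C hγ le_rfl
  have e2 := mul_log_div_le_rpow C hγ (show γ ≤ γ + U by linarith)
  have h1 := abs_le.mp ((hlad γ hγT).trans e1)
  have h2 := abs_le.mp ((hlad _ hT').trans e2)
  have t1 := tangent_le_mul_log_sub hx hy
  have t2 := mul_log_sub_le_tangent_add hx hy
  rw [← sub_div] at t1 t2
  rw [integral_Z2_sub, aConst]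
  refine ⟨sub_pos.mpr (hmono hγT hT' (by linarith)), ?_, ?_⟩
  · linarith [h1.2, h2.1]
  · linarith [h1.1, h2.2]

/-- Under Balasubramanian's formula, a Jacob's ladder grows by `O(γ ^ p)` over steps of length at
most `γ ^ p`, for every exponent `p > 1/3`. -/
lemma ladder_increment_le_rpow {φ : ℝ → ℝ} {T₀ : ℝ}
    (hmono : StrictMonoOn φ (Set.Ici T₀)) (hpos : ∀ T ≥ T₀, 0 < φ T)
    (hladder : ∃ c₀ C : ℝ, ∀ T ≥ T₀,
      |(∫ t in (0:ℝ)..T, Z2 t) - (φ T / 2) * Real.log (φ T / 2)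
        - (Real.eulerMascheroniConstant - Real.log (2 * Real.pi)) * (φ T / 2) - c₀|
        ≤ C * Real.log T / T)
    {k₁ k₂ : ℝ} (hk₁ : 0 < k₁) (hk₁₂ : k₁ ≤ k₂)
    (hgrowth : ∀ T ≥ T₀, k₁ * T ≤ φ T ∧ φ T ≤ k₂ * T)
    (hBal : ∀ ε > (0:ℝ), ∃ C T₁ : ℝ, ∀ T ≥ T₁,
      |(∫ t in (0:ℝ)..T, Z2 t) - T * Real.log T
        - (2 * Real.eulerMascheroniConstant - 1 - Real.log (2 * Real.pi)) * T|
        ≤ C * T ^ ((1:ℝ)/3 + ε))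
    {p : ℝ} (hp : 1 / 3 < p) :
    ∃ K Γ : ℝ, ∀ γ ≥ Γ, ∀ U : ℝ, 0 < U → U ≤ γ ^ p → (φ (γ + U) - φ γ) / 2 ≤ K * γ ^ p := by
  have hk₂ : 0 < k₂ := hk₁.trans_le hk₁₂
  rcases le_total 1 p with hp1 | hp1
  · refine ⟨k₂, max 1 T₀, fun γ hγ U hU hUp => ?_⟩
    have hγ1 : 1 ≤ γ := (le_max_left _ _).trans hγ
    have hγT : T₀ ≤ γ := (le_max_right _ _).trans hγ
    have h1 := (hgrowth (γ + U) (by linarith)).2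
    have h2 := hpos γ hγT
    have h3 : γ ≤ γ ^ p := Real.self_le_rpow_of_one_le hγ1 hp1
    have h4 : k₂ * (γ + U) ≤ k₂ * (2 * γ ^ p) := by gcongr; linarith
    linarith
  · obtain ⟨c₀, C, hlad⟩ := hladder
    obtain ⟨B, T₁, hB⟩ := hBal (p - 1/3) (by linarith)
    rw [show (1:ℝ)/3 + (p - 1/3) = p by ring] at hB
    set b : ℝ := Real.log 2 + 2 * Real.eulerMascheroniConstant - Real.log (2 * Real.pi) with hb
    obtain ⟨Γ₀, hΓ₀⟩ := eventually_atTop.mp (Real.tendsto_log_atTop.eventually_ge_atTop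
      (max 1 (max b (2 * (aConst - Real.log (k₁ / 2))))))
    refine ⟨4 + 8 * |B| + 6 * |C|, max (max 1 Γ₀) (max T₀ T₁), fun γ hγ U hU hUp => ?_⟩
    simp only [ge_iff_le, max_le_iff] at hγ hΓ₀
    obtain ⟨⟨hγ1, hγ0⟩, hγT, hγT₁⟩ := hγ
    obtain ⟨l1, l2, l3⟩ := hΓ₀ γ hγ0
    have hUγ : U ≤ γ := hUp.trans (by
      simpa using Real.rpow_le_rpow_of_exponent_le hγ1 hp1)
    have hup := integral_Z2_sub_le (by linarith) hp1 hB hγ1 hγT₁ hU hUγ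
    obtain ⟨hD, hlow, -⟩ := ladder_increment_bounds hmono hpos hlad hγ1 hγT hU
    rw [← hb] at hup
    have hlog : Real.log γ / 2 ≤ Real.log (φ γ / 2) - aConst := by
      have h : Real.log (k₁ / 2 * γ) ≤ Real.log (φ γ / 2) :=
        Real.log_le_log (by positivity) (by linarith [(hgrowth γ hγT).1])
      rw [Real.log_mul (by positivity) (by positivity)] at h
      linarith
    have hE : γ ^ (-(1:ℝ)/3) ≤ γ ^ p := Real.rpow_le_rpow_of_exponent_le hγ1 (by linarith)
    have hE' : |C| * γ ^ (-(1:ℝ)/3) ≤ |C| * γ ^ p := by gcongr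
    have hUb : U * (Real.log γ + b) ≤ γ ^ p * (2 * Real.log γ) :=
      (mul_le_mul_of_nonneg_left (by linarith) hU.le).trans
        (mul_le_mul_of_nonneg_right hUp (by linarith))
    have hDl := mul_le_mul_of_nonneg_left hlog (half_pos hD).le
    have hrest : 0 ≤ (4 * |B| + 3 * |C|) * γ ^ p := by positivity
    have hrest' := mul_le_mul_of_nonneg_left l1 hrest
    have hlogpos : 0 < Real.log γ / 2 := by linarith
    refine le_of_mul_le_mul_right ?_ hlogpos
    linarith

theorem microscopic_parts_rotating_chord
    (φ : ℝ → ℝ) (T₀ : ℝ)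
    (hcont : ContinuousOn φ (Set.Ici T₀))
    (hmono : StrictMonoOn φ (Set.Ici T₀))
    (hpos : ∀ T ≥ T₀, 0 < φ T)
    (hladder : ∃ c₀ C : ℝ, ∀ T ≥ T₀,
      |(∫ t in (0:ℝ)..T, Z2 t) - (φ T / 2) * Real.log (φ T / 2)
        - (Real.eulerMascheroniConstant - Real.log (2 * Real.pi)) * (φ T / 2) - c₀|
        ≤ C * Real.log T / T)
    (k₁ k₂ : ℝ) (hk₁ : 0 < k₁) (hk₁₂ : k₁ ≤ k₂)
    (hgrowth : ∀ T ≥ T₀, k₁ * T ≤ φ T ∧ φ T ≤ k₂ * T)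
    (hBal : ∀ ε > (0:ℝ), ∃ C T₁ : ℝ, ∀ T ≥ T₁,
      |(∫ t in (0:ℝ)..T, Z2 t) - T * Real.log T
        - (2 * Real.eulerMascheroniConstant - 1 - Real.log (2 * Real.pi)) * T|
        ≤ C * T ^ ((1:ℝ)/3 + ε))
    (ε : ℝ) (hε : 0 < ε) :
    ∃ C Γ : ℝ, ∀ γ ≥ Γ, riemannZeta (1/2 + Complex.I * γ) = 0 →
      ∀ U : ℝ, 0 < U → U ≤ γ ^ ((1:ℝ)/3 + 2*ε) →
      |(∫ t in γ..(γ + U), Z2 t)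
        - (U * Real.log (φ γ / 2) - aConst * U) * ((φ (γ + U) - φ γ) / (2 * U))|
        ≤ C * γ ^ (-((1:ℝ)/3 - 4*ε)) := by
  obtain ⟨K, Γ, hK⟩ := ladder_increment_le_rpow hmono hpos hladder hk₁ hk₁₂ hgrowth hBal
    (show (1:ℝ) / 3 < 1 / 3 + 2 * ε by linarith)
  obtain ⟨c₀, C, hlad⟩ := hladder
  refine ⟨3 * |C| + 2 * K ^ 2 / k₁, max Γ (max 1 T₀), fun γ hγ _ U hU hUp => ?_⟩
  simp only [ge_iff_le, max_le_iff] at hγ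
  obtain ⟨hγΓ, hγ1, hγT⟩ := hγ
  have hγ0 : 0 < γ := by linarith
  obtain ⟨hD, hlow, hup⟩ := ladder_increment_bounds hmono hpos hlad hγ1 hγT hU
  have hDK := hK γ hγΓ U hU hUp
  have hmain : (U * Real.log (φ γ / 2) - aConst * U) * ((φ (γ + U) - φ γ) / (2 * U))
      = (φ (γ + U) - φ γ) / 2 * (Real.log (φ γ / 2) - aConst) := by
    field_simp
  have hsq : ((φ (γ + U) - φ γ) / 2) ^ 2 / (φ γ / 2)
      ≤ 2 * K ^ 2 / k₁ * γ ^ (-((1:ℝ)/3 - 4*ε)) := calc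
    _ ≤ (K * γ ^ ((1:ℝ)/3 + 2*ε)) ^ 2 / (k₁ * γ / 2) := by
        have := (hgrowth γ hγT).1
        have := half_pos hD
        gcongr
    _ = 2 * K ^ 2 / k₁ * ((γ ^ ((1:ℝ)/3 + 2*ε)) ^ 2 / γ) := by field_simp
    _ = _ := by
        rw [← Real.rpow_mul_natCast hγ0.le, ← Real.rpow_sub_one hγ0.ne']
        congr 2
        push_cast
        ring
  have hsq0 : 0 ≤ ((φ (γ + U) - φ γ) / 2) ^ 2 / (φ γ / 2) :=
    div_nonneg (sq_nonneg _) (half_pos (hpos γ hγT)).le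
  have hE : |C| * γ ^ (-(1:ℝ)/3) ≤ |C| * γ ^ (-((1:ℝ)/3 - 4*ε)) :=
    mul_le_mul_of_nonneg_left
      (Real.rpow_le_rpow_of_exponent_le hγ1 (by linarith)) (abs_nonneg C)
  rw [hmain, abs_le]
  constructor <;> linarith
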